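/- Fix G, μ > 0, let g(r) = (4/(√π r)) ∫₀^{μ²r²/4} √t e^{-t} dt and let m_c = 1/(G·max_{r>0} g(r)) be the critical mass. Then for every m > m_c the lapse function A_m(r) = 1 − G m g(r) has at least two zeros 0 < r₋ < r₊ (an inner and an outer horizon): A_m(r₋) = A_m(r₊) = 0 and A_m is negative somewhere between them, while A_m(r) → 1 as r → 0⁺ and as r → ∞. -/

import Mathlib

open Real MeasureTheory Set Filter Topology

/-- The incomplete Gamma integral of exponent `3/2` is bounded by `2 (1 - e^{-x/2})`. -/
lemma integral_sqrt_mul_exp_neg_le {x : ℝ} (hx : 0 ≤ x) :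
    ∫ t in (0:ℝ)..x, √t * Real.exp (-t) ≤ 2 * (1 - Real.exp (-(x / 2))) := by
  have hprim : ∫ t in (0:ℝ)..x, Real.exp (-(t / 2)) = 2 * (1 - Real.exp (-(x / 2))) := by
    have hderiv : ∀ t ∈ uIcc 0 x,
        HasDerivAt (fun t : ℝ => -2 * Real.exp (-(t / 2))) (Real.exp (-(t / 2))) t := by
      intro t _
      exact ((((hasDerivAt_id' t).div_const 2).fun_neg).exp.const_mul (-2 : ℝ)).congr_deriv (by ring)
    rw [intervalIntegral.integral_eq_sub_of_hasDerivAt hderiv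
      (Continuous.intervalIntegrable (by fun_prop) _ _)]
    simp
    ring
  rw [← hprim]
  refine intervalIntegral.integral_mono_on hx (Continuous.intervalIntegrable (by fun_prop) _ _)
    (Continuous.intervalIntegrable (by fun_prop) _ _) fun t _ => ?_
  have hsqrt : √t ≤ Real.exp (t / 2) := by
    rw [Real.exp_half]
    exact Real.sqrt_le_sqrt (by linarith [Real.add_one_le_exp t])
  calc √t * Real.exp (-t) ≤ Real.exp (t / 2) * Real.exp (-t) := by gcongr
    _ = Real.exp (-(t / 2)) := by rw [← Real.exp_add]; congr 1; ring

lemma integral_sqrt_mul_exp_neg_pos {x : ℝ} (hx : 0 < x) :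
    0 < ∫ t in (0:ℝ)..x, √t * Real.exp (-t) :=
  intervalIntegral.intervalIntegral_pos_of_pos_on
    (Continuous.intervalIntegrable (by fun_prop) _ _)
    (fun _ ht => mul_pos (Real.sqrt_pos.2 ht.1) (Real.exp_pos _)) hx

lemma continuous_integral_sqrt_mul_exp_neg :
    Continuous fun x : ℝ => ∫ t in (0:ℝ)..x, √t * Real.exp (-t) :=
  intervalIntegral.continuous_primitive
    (fun _ _ => Continuous.intervalIntegrable (by fun_prop) _ _) 0

/-- Above the critical mass, the Gaussian non-local lapse `A_m(r) = 1 − Gm g(r)`, with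
`g(r) = (4/(√π r)) ∫₀^{μ²r²/4} √t e^{-t} dt` and `r₀` a maximizer of `g` on `(0,∞)` (so that
`m_c = 1/(G g(r₀))`), has at least two horizons: for every `m > m_c` there are
`0 < r₋ < r₊` with `A_m(r₋) = A_m(r₊) = 0`, `A_m` negative somewhere between them, while
`A_m(r) → 1` as `r → 0⁺` and as `r → ∞`. -/
theorem gaussian_lapse_two_horizons
    (G μ : ℝ) (hG : 0 < G) (hμ : 0 < μ)
    (g : ℝ → ℝ)
    (hg : ∀ r : ℝ, g r = 4 / (Real.sqrt π * r) *
      ∫ t in (0:ℝ)..(μ ^ 2 * r ^ 2 / 4), Real.sqrt t * Real.exp (-t))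
    (r₀ : ℝ) (hr₀ : 0 < r₀) (hmax : ∀ r : ℝ, 0 < r → g r ≤ g r₀)
    (m : ℝ) (hm : 1 / (G * g r₀) < m) :
    (∃ rm rp : ℝ, 0 < rm ∧ rm < rp ∧
      1 - G * m * g rm = 0 ∧ 1 - G * m * g rp = 0 ∧
      ∃ r : ℝ, rm < r ∧ r < rp ∧ 1 - G * m * g r < 0) ∧
    Tendsto (fun r => 1 - G * m * g r) (nhdsWithin 0 (Ioi 0)) (nhds 1) ∧
    Tendsto (fun r => 1 - G * m * g r) atTop (nhds 1) := by
  have hsπ : 0 < √π := Real.sqrt_pos.2 Real.pi_pos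
  have hpos : ∀ r, 0 < r → 0 < g r := fun r hr => by
    rw [hg]
    exact mul_pos (by positivity) (integral_sqrt_mul_exp_neg_pos (by positivity))
  have hle_near : ∀ r, 0 < r → g r ≤ μ ^ 2 / √π * r := fun r hr => by
    have hx : 0 ≤ μ ^ 2 * r ^ 2 / 4 := by positivity
    have hF := integral_sqrt_mul_exp_neg_le hx
    have hexp := Real.add_one_le_exp (-((μ ^ 2 * r ^ 2 / 4) / 2))
    calc g r ≤ 4 / (√π * r) * (μ ^ 2 * r ^ 2 / 4) := by
          rw [hg]
          gcongr
          linarith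
      _ = μ ^ 2 / √π * r := by field_simp
  have hle_far : ∀ r, 0 < r → g r ≤ 8 / √π * r⁻¹ := fun r hr => by
    have hx : 0 ≤ μ ^ 2 * r ^ 2 / 4 := by positivity
    have hF := integral_sqrt_mul_exp_neg_le hx
    have hexp := Real.exp_pos (-((μ ^ 2 * r ^ 2 / 4) / 2))
    calc g r ≤ 4 / (√π * r) * 2 := by
          rw [hg]
          gcongr
          linarith
      _ = 8 / √π * r⁻¹ := by field_simp; norm_num
  have hzero : Tendsto g (𝓝[>] 0) (𝓝 0) := by
    have hb : Tendsto (fun r : ℝ => μ ^ 2 / √π * r) (𝓝[>] 0) (𝓝 0) := by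
      have h : Continuous fun r : ℝ => μ ^ 2 / √π * r := by fun_prop
      simpa using (h.tendsto 0).mono_left nhdsWithin_le_nhds
    refine tendsto_of_tendsto_of_tendsto_of_le_of_le' tendsto_const_nhds hb ?_ ?_
    · filter_upwards [self_mem_nhdsWithin] with r hr using (hpos r hr).le
    · filter_upwards [self_mem_nhdsWithin] with r hr using hle_near r hr
  have htop : Tendsto g atTop (𝓝 0) := by
    have hb : Tendsto (fun r : ℝ => 8 / √π * r⁻¹) atTop (𝓝 0) := by
      simpa using tendsto_inv_atTop_zero.const_mul (8 / √π)
    refine tendsto_of_tendsto_of_tendsto_of_le_of_le' tendsto_const_nhds hb ?_ ?_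
    · filter_upwards [eventually_gt_atTop 0] with r hr using (hpos r hr).le
    · filter_upwards [eventually_gt_atTop 0] with r hr using hle_far r hr
  have hAzero : Tendsto (fun r => 1 - G * m * g r) (𝓝[>] 0) (𝓝 1) := by
    simpa using (hzero.const_mul (G * m)).const_sub 1
  have hAtop : Tendsto (fun r => 1 - G * m * g r) atTop (𝓝 1) := by
    simpa using (htop.const_mul (G * m)).const_sub 1
  refine ⟨?_, hAzero, hAtop⟩
  have hcont : ContinuousOn (fun r => 1 - G * m * g r) (Ioi 0) := by
    have hgc : ContinuousOn g (Ioi 0) := by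
      rw [funext hg]
      refine ContinuousOn.mul (continuousOn_const.div (by fun_prop) fun r hr => ?_)
        (continuous_integral_sqrt_mul_exp_neg.comp
          (g := fun x : ℝ => ∫ t in (0:ℝ)..x, √t * Real.exp (-t))
          (f := fun r : ℝ => μ ^ 2 * r ^ 2 / 4) (by fun_prop)).continuousOn
      exact (mul_pos hsπ hr).ne'
    fun_prop
  have hneg : 1 - G * m * g r₀ < 0 := by
    have h := (div_lt_iff₀ (mul_pos hG (hpos r₀ hr₀))).1 hm
    linarith
  obtain ⟨a, haA, ha, har⟩ := ((hAzero.eventually_const_lt one_pos).and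
    (Ioo_mem_nhdsGT hr₀)).exists
  obtain ⟨b, hbA, hb⟩ := ((hAtop.eventually_const_lt one_pos).and
    (eventually_gt_atTop r₀)).exists
  obtain ⟨rm, hrm, hrm0⟩ := intermediate_value_Ioo' har.le
    (hcont.mono fun r hr => ha.trans_le hr.1) ⟨hneg, haA⟩
  obtain ⟨rp, hrp, hrp0⟩ := intermediate_value_Ioo hb.le
    (hcont.mono fun r hr => hr₀.trans_le hr.1) ⟨hneg, hbA⟩
  exact ⟨rm, rp, ha.trans hrm.1, hrm.2.trans hrp.1, hrm0, hrp0, r₀, hrm.2, hrp.1, hneg⟩
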